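/- Strong completeness: for every n ≥ 1, every set of formulas Γ and every formula α, if Γ ⊨_n α then Γ ⊢_n α. -/

import Mathlib

/-- Formulas of intuitionistic propositional logic, built from propositional
variables `p_0, p_1, …` (indexed by `ℕ`) and `⊥` using `∧`, `∨`, `→`. -/
inductive Form : Type
  | var : ℕ → Form
  | bot : Form
  | and : Form → Form → Form
  | or : Form → Form → Form
  | imp : Form → Form → Form
  deriving DecidableEq

namespace Form

/-- `¬α` abbreviates `α → ⊥`. -/
def neg (φ : Form) : Form := φ.imp .bot

/-- `⊤` abbreviates `⊥ → ⊥`. -/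
def top : Form := Form.bot.imp .bot

/-- The set of propositional variables occurring in a formula. -/
def vars : Form → Set ℕ
  | var p => {p}
  | bot => ∅
  | and φ ψ => φ.vars ∪ ψ.vars
  | or φ ψ => φ.vars ∪ ψ.vars
  | imp φ ψ => φ.vars ∪ ψ.vars

/-- Uniform substitution, extended homomorphically to all formulas. -/
def subst (σ : ℕ → Form) : Form → Form
  | var p => σ p
  | bot => bot
  | and φ ψ => (φ.subst σ).and (ψ.subst σ)
  | or φ ψ => (φ.subst σ).or (ψ.subst σ)
  | imp φ ψ => (φ.subst σ).imp (ψ.subst σ)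

end Form

/-- A valuation `V` on a poset is intuitionistic when every `V p` is upward closed. -/
def IsVal {P : Type} [PartialOrder P] (V : ℕ → Set P) : Prop :=
  ∀ p, ∀ x y : P, x ≤ y → x ∈ V p → y ∈ V p

/-- The standard Kripke forcing relation for intuitionistic propositional logic. -/
def forces {P : Type} [PartialOrder P] (V : ℕ → Set P) : P → Form → Prop
  | w, .var p => w ∈ V p
  | _, .bot => False
  | w, .and φ ψ => forces V w φ ∧ forces V w ψ
  | w, .or φ ψ => forces V w φ ∨ forces V w ψ
  | w, .imp φ ψ => ∀ v, w ≤ v → forces V v φ → forces V v ψ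

/-- A point `w` of a poset validates `φ` if `φ` is forced at `w` under every
intuitionistic valuation. -/
def valid {P : Type} [PartialOrder P] (w : P) (φ : Form) : Prop :=
  ∀ V : ℕ → Set P, IsVal V → forces V w φ

/-- Semantic consequence at a point: `Γ ⊨_{P,w} φ`. -/
def Conseq {P : Type} [PartialOrder P] (Γ : Set Form) (w : P) (φ : Form) : Prop :=
  ∀ V : ℕ → Set P, IsVal V → (∀ γ ∈ Γ, forces V w γ) → forces V w φ

/-- The n-Medvedev frame: nonempty subsets of `{0,…,n−1}`. -/
def Med (n : ℕ) : Type := {X : Finset (Fin n) // X.Nonempty}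

/-- The order on the n-Medvedev frame is reverse inclusion `⊇`. -/
instance (n : ℕ) : PartialOrder (Med n) where
  le X Y := Y.1 ⊆ X.1
  le_refl X := Finset.Subset.refl _
  le_trans X Y Z h1 h2 := Finset.Subset.trans h2 h1
  le_antisymm X Y h1 h2 := Subtype.ext (Finset.Subset.antisymm h2 h1)

instance (n : ℕ) : Fintype (Med n) :=
  inferInstanceAs (Fintype {X : Finset (Fin n) // X.Nonempty})

/-- The root (least element) of the n-Medvedev frame: the full set `{0,…,n−1}`. -/
def root (n : ℕ) (hn : 1 ≤ n) : Med n := ⟨Finset.univ, ⟨⟨0, hn⟩, Finset.mem_univ _⟩⟩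

/-- `endSet w` is the set of end points (maximal elements) above `w`. -/
def endSet {P : Type} [PartialOrder P] (w : P) : Set P := {e | IsMax e ∧ w ≤ e}

/-- Finite disjunction `⋁_{i} F i` (the empty disjunction is `⊥`). -/
def bigDisj (n : ℕ) (F : Fin n → Form) : Form :=
  (List.finRange n).foldr (fun i acc => (F i).or acc) .bot

/-- `λ_i = p_i ∧ ⋀_{j ≠ i} ¬ p_j`, for a choice `p : Fin n → ℕ` of variables. -/
def lam (n : ℕ) (p : Fin n → ℕ) (i : Fin n) : Form :=
  (Form.var (p i)).and
    (((List.finRange n).filter (fun j => j ≠ i)).foldr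
      (fun j acc => ((Form.var (p j)).neg).and acc) Form.top)

/-- A Hilbert-style axiomatization of intuitionistic propositional logic. -/
inductive IPC : Form → Prop
  | ax1 (φ ψ : Form) : IPC (φ.imp (ψ.imp φ))
  | ax2 (φ ψ χ : Form) : IPC ((φ.imp (ψ.imp χ)).imp ((φ.imp ψ).imp (φ.imp χ)))
  | andI (φ ψ : Form) : IPC (φ.imp (ψ.imp (φ.and ψ)))
  | andE1 (φ ψ : Form) : IPC ((φ.and ψ).imp φ)
  | andE2 (φ ψ : Form) : IPC ((φ.and ψ).imp ψ)
  | orI1 (φ ψ : Form) : IPC (φ.imp (φ.or ψ))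
  | orI2 (φ ψ : Form) : IPC (ψ.imp (φ.or ψ))
  | orE (φ ψ χ : Form) : IPC ((φ.imp χ).imp ((ψ.imp χ).imp ((φ.or ψ).imp χ)))
  | botE (φ : Form) : IPC (Form.bot.imp φ)
  | mp {φ ψ : Form} : IPC (φ.imp ψ) → IPC φ → IPC ψ

/-- The Kreisel–Putnam formula `(¬p → q ∨ r) → ((¬p → q) ∨ (¬p → r))`. -/
def kpForm : Form :=
  ((Form.var 0).neg.imp ((Form.var 1).or (Form.var 2))).imp
    (((Form.var 0).neg.imp (Form.var 1)).or ((Form.var 0).neg.imp (Form.var 2)))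

/-- The bounded-depth formulas: `bd_1 = p_1 ∨ (p_1 → ⊥)`,
`bd_{k+1} = p_{k+1} ∨ (p_{k+1} → bd_k)`. -/
def bd : ℕ → Form
  | 0 => .bot
  | k + 1 => (Form.var (k + 1)).or ((Form.var (k + 1)).imp (bd k))

/-- `ML_n`: the smallest set of formulas containing all theorems of intuitionistic
propositional logic and all substitution instances of `kp` and `bd_n`, closed under
modus ponens, uniform substitution, and the Gabbay-style rule `Ed_n`. -/
inductive MLn (n : ℕ) : Form → Prop
  | ipc {φ : Form} : IPC φ → MLn n φ
  | kp : MLn n kpForm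
  | bdn : MLn n (bd n)
  | mp {φ ψ : Form} : MLn n (φ.imp ψ) → MLn n φ → MLn n ψ
  | subst {φ : Form} (σ : ℕ → Form) : MLn n φ → MLn n (φ.subst σ)
  | ed {α β : Form} (p : Fin n → ℕ) : Function.Injective p →
      (∀ i, p i ∉ α.vars ∧ p i ∉ β.vars) →
      MLn n (α.imp (β.or (bigDisj n fun i => (lam n p i).neg))) →
      MLn n (α.imp β)

/-- `Γ ⊢_n φ`: there are finitely many `γ_1, …, γ_k ∈ Γ` with
`(γ_1 ∧ … ∧ γ_k) → φ ∈ ML_n`. -/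
def Proves (n : ℕ) (Γ : Set Form) (φ : Form) : Prop :=
  ∃ l : List Form, (∀ γ ∈ l, γ ∈ Γ) ∧ MLn n ((l.foldr Form.and Form.top).imp φ)

/-- Disjunction `⋁_{i ∈ I} F i` over a finite set of indices. -/
def disjOver {n : ℕ} (I : Finset (Fin n)) (F : Fin n → Form) : Form :=
  ((List.finRange n).filter (fun i => i ∈ I)).foldr (fun i acc => (F i).or acc) .bot

/-- `α_I = ¬¬ ⋁_{i ∈ I} α_i`. -/
def alphaI {n : ℕ} (I : Finset (Fin n)) (α : Fin n → Form) : Form :=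
  ((disjOver I α).neg).neg

open Classical in
/-- `α_S = ⋁_{I ∈ S} α_I` for a set `S` of points of the n-Medvedev frame
(with `α_∅ = ⊥`). -/
noncomputable def alphaS {n : ℕ} (S : Set (Med n)) (α : Fin n → Form) : Form :=
  ((Finset.univ : Finset (Med n)).filter (fun I => I ∈ S)).toList.foldr
    (fun I acc => (alphaI I.1 α).or acc) .bot

/-! ### Posets isomorphic to a Medvedev frame -/

section Frame

variable {X : Type} [PartialOrder X]

/-- `HasChain k x` says that some strictly increasing chain of `k + 1` points starts at `x`. -/
def HasChain : ℕ → X → Prop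
  | 0, _ => True
  | k + 1, x => ∃ y, x < y ∧ HasChain k y

theorem HasChain.anti {k : ℕ} {x y : X} (hxy : x ≤ y) (h : HasChain k y) : HasChain k x := by
  cases k with
  | zero => trivial
  | succ k =>
    obtain ⟨z, hyz, hz⟩ := h
    exact ⟨z, hxy.trans_lt hyz, hz⟩

/-- The Kreisel–Putnam condition: points `y`, `z` above `x` have a common lower bound above `x`
whose end points all lie above `y` or above `z`. -/
def IsKPOrder (X : Type) [PartialOrder X] : Prop :=
  ∀ x y z : X, x ≤ y → x ≤ z →
    ∃ u, x ≤ u ∧ u ≤ y ∧ u ≤ z ∧ ∀ e, IsMax e → u ≤ e → y ≤ e ∨ z ≤ e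

theorem HasChain.extend_below {w : X} (hw : ∀ x, w ≤ x) (kp : IsKPOrder X) (T : Finset X) :
    ∀ (k : ℕ) (x : X), HasChain k x → (∀ e ∈ T, IsMax e ∧ ¬ x ≤ e) →
      ∃ y : X, HasChain (k + T.card) y := by
  classical
  induction T using Finset.induction_on with
  | empty =>
    intro k x h _
    exact ⟨x, h⟩
  | insert e T heT ih =>
    intro k x hx hT
    obtain ⟨u, -, hux, hue, hu⟩ := kp w x e (hw x) (hw e)
    have hxe := (hT e (Finset.mem_insert_self e T)).2
    have hlt : u < x := lt_of_le_of_ne hux fun h => hxe (h ▸ hue)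
    obtain ⟨y, hy⟩ := ih (k + 1) u ⟨x, hlt, hx⟩ fun e' he' => by
      obtain ⟨hmax, hnot⟩ := hT e' (Finset.mem_insert_of_mem he')
      refine ⟨hmax, fun h => ?_⟩
      rcases hu e' hmax h with h | h
      · exact hnot h
      · have hee : e = e' :=
          le_antisymm h ((hT e (Finset.mem_insert_self e T)).1 h)
        exact heT (hee ▸ he')
    refine ⟨y, ?_⟩
    rw [Finset.card_insert_of_notMem heT, ← add_assoc, add_right_comm]
    exact hy

theorem IsKPOrder.exists_ends_eq (kp : IsKPOrder X) (x : X) {S : Finset X} (hS : S.Nonempty)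
    (hx : ∀ e ∈ S, IsMax e ∧ x ≤ e) :
    ∃ u, x ≤ u ∧ (∀ e, IsMax e → (u ≤ e ↔ e ∈ S)) ∧ HasChain (S.card - 1) u := by
  classical
  induction hS using Finset.Nonempty.cons_induction with
  | singleton a =>
    obtain ⟨hmax, hxa⟩ := hx a (Finset.mem_singleton_self a)
    refine ⟨a, hxa, fun e _ => ?_, ?_⟩
    · rw [Finset.mem_singleton]
      exact ⟨fun h => le_antisymm (hmax h) h, fun h => h.ge⟩
    · rw [Finset.card_singleton]
      trivial
  | cons a S haS hS ih =>
    obtain ⟨v, hxv, hv, hchain⟩ := ih fun e he => hx e (Finset.mem_cons_of_mem he)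
    obtain ⟨hmax, hxa⟩ := hx a (Finset.mem_cons_self a S)
    obtain ⟨u, hxu, huv, hua, hu⟩ := kp x v a hxv hxa
    refine ⟨u, hxu, fun e he => ?_, ?_⟩
    · rw [Finset.mem_cons]
      constructor
      · intro h
        rcases hu e he h with h | h
        · exact Or.inr ((hv e he).1 h)
        · exact Or.inl (le_antisymm (hmax h) h)
      · rintro (rfl | h)
        · exact hua
        · exact huv.trans ((hv e he).2 h)
    · have hlt : u < v := lt_of_le_of_ne huv fun h => haS ((hv a hmax).1 (h ▸ hua))
      have hcard : (Finset.cons a S haS).card - 1 = (S.card - 1) + 1 := by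
        have := hS.card_pos
        rw [Finset.card_cons]
        omega
      rw [hcard]
      exact ⟨v, hlt, hchain⟩

/-- A rooted Kreisel–Putnam order without chains of `n + 1` points, with at least `n` end points
and an end point above every point, is isomorphic to the `n`-Medvedev frame. -/
theorem IsKPOrder.nonempty_orderIso_med {n : ℕ} {w : X} (hw : ∀ x, w ≤ x) (kp : IsKPOrder X)
    (hmax : ∀ x : X, ∃ e, IsMax e ∧ x ≤ e) (hdepth : ∀ x : X, ¬ HasChain n x)
    (e : Fin n → X) (he : Function.Injective e) (hem : ∀ i, IsMax (e i)) :
    Nonempty (X ≃o Med n) := by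
  classical
  have hends : ∀ m, IsMax m → ∃ i, e i = m := by
    intro m hm
    by_contra! hne
    obtain ⟨y, hy⟩ := HasChain.extend_below hw kp (Finset.univ.image e) 0 m trivial (by
      intro e' he'
      obtain ⟨i, -, rfl⟩ := Finset.mem_image.1 he'
      exact ⟨hem i, fun h => hne i (le_antisymm (hm h) h)⟩)
    rw [Finset.card_image_of_injective _ he, Finset.card_univ, Fintype.card_fin, zero_add] at hy
    exact hdepth y hy
  let E : X → Finset (Fin n) := fun x => Finset.univ.filter fun i => x ≤ e i
  have memE : ∀ x i, i ∈ E x ↔ x ≤ e i := fun x i => by simp [E]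
  have hE : ∀ x, (E x).Nonempty := fun x => by
    obtain ⟨m, hm, hxm⟩ := hmax x
    obtain ⟨i, rfl⟩ := hends m hm
    exact ⟨i, (memE x i).2 hxm⟩
  have exact_ends : ∀ x (S : Finset (Fin n)), S.Nonempty → S ⊆ E x →
      ∃ u, x ≤ u ∧ E u = S ∧ HasChain (S.card - 1) u := by
    intro x S hS hSx
    obtain ⟨u, hxu, hu, hc⟩ := kp.exists_ends_eq x (S := S.image e) (hS.image e) (by
      intro e' he'
      obtain ⟨i, hi, rfl⟩ := Finset.mem_image.1 he'
      exact ⟨hem i, (memE x i).1 (hSx hi)⟩)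
    refine ⟨u, hxu, ?_, ?_⟩
    · ext i
      rw [memE, hu _ (hem i), he.mem_finset_image]
    · rwa [Finset.card_image_of_injective _ he] at hc
  have no_lt : ∀ v v', v < v' → E v ≠ E v' := by
    intro v v' hlt heq
    obtain ⟨u, hvu, -, hc⟩ := exact_ends v' (E v') (hE v') subset_rfl
    have hv : HasChain ((E v').card - 1 + 1) v := ⟨v', hlt, hc.anti hvu⟩
    obtain ⟨y, hy⟩ := HasChain.extend_below hw kp ((E v')ᶜ.image e) _ v hv (by
      intro e' he'
      obtain ⟨i, hi, rfl⟩ := Finset.mem_image.1 he'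
      rw [← heq, Finset.mem_compl, memE] at hi
      exact ⟨hem i, hi⟩)
    rw [Finset.card_image_of_injective _ he, Finset.card_compl, Fintype.card_fin] at hy
    have h1 := (hE v').card_pos
    have h2 := Finset.card_le_univ (E v')
    rw [Fintype.card_fin] at h2
    have h3 : (E v').card - 1 + 1 + (n - (E v').card) = n := by omega
    rw [h3] at hy
    exact hdepth y hy
  have reflects : ∀ x y, E y ⊆ E x → x ≤ y := by
    intro x y hyx
    obtain ⟨u, hxu, hu, -⟩ := exact_ends x (E y) (hE y) hyx
    obtain ⟨t, -, htu, hty, ht⟩ := kp w u y (hw u) (hw y)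
    have hEt : E t = E y := by
      ext i
      rw [memE, memE]
      refine ⟨fun h => ?_, hty.trans⟩
      rcases ht _ (hem i) h with h | h
      · rwa [← memE, ← hu, memE]
      · exact h
    have h1 : t = y := by
      by_contra hne
      exact no_lt t y (lt_of_le_of_ne hty hne) hEt
    have h2 : t = u := by
      by_contra hne
      exact no_lt t u (lt_of_le_of_ne htu hne) (hEt.trans hu.symm)
    exact hxu.trans (h2.symm.trans h1).le
  let f : X ↪o Med n := OrderEmbedding.ofMapLEIff (fun x => (⟨E x, hE x⟩ : Med n)) fun x y =>
    ⟨fun h => reflects x y h, fun h i hi => (memE x i).2 (h.trans ((memE y i).1 hi))⟩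
  refine ⟨RelIso.ofSurjective f fun S => ?_⟩
  obtain ⟨u, -, hu, -⟩ := exact_ends w S.1 S.2 fun i _ => (memE w i).2 (hw _)
  exact ⟨u, Subtype.ext hu⟩

end Frame

/-! ### Forcing -/

theorem forces_orderIso {P Q : Type} [PartialOrder P] [PartialOrder Q] (f : P ≃o Q)
    (V : ℕ → Set P) (φ : Form) (x : P) :
    forces (fun p => f '' V p) (f x) φ ↔ forces V x φ := by
  induction φ generalizing x with
  | var p => exact f.injective.mem_set_image
  | bot => exact Iff.rfl
  | and φ ψ ihφ ihψ => exact and_congr (ihφ x) (ihψ x)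
  | or φ ψ ihφ ihψ => exact or_congr (ihφ x) (ihψ x)
  | imp φ ψ ihφ ihψ =>
    constructor
    · intro h v hxv hv
      exact (ihψ v).1 (h (f v) (f.le_iff_le.2 hxv) ((ihφ v).2 hv))
    · intro h v hxv hv
      obtain ⟨v, rfl⟩ := f.surjective v
      exact (ihψ v).2 (h v (f.le_iff_le.1 hxv) ((ihφ v).1 hv))

theorem forces_subst {P : Type} [PartialOrder P] (V : ℕ → Set P) (σ : ℕ → Form) (φ : Form)
    (x : P) :
    forces V x (φ.subst σ) ↔ forces (fun p => {y | forces V y (σ p)}) x φ := by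
  induction φ generalizing x with
  | var p => exact Iff.rfl
  | bot => exact Iff.rfl
  | and φ ψ ihφ ihψ => exact and_congr (ihφ x) (ihψ x)
  | or φ ψ ihφ ihψ => exact or_congr (ihφ x) (ihψ x)
  | imp φ ψ ihφ ihψ =>
    exact forall_congr' fun v => imp_congr_right fun _ => imp_congr (ihφ v) (ihψ v)

/-! ### Substitution -/

namespace Form

theorem subst_subst (σ τ : ℕ → Form) (φ : Form) :
    (φ.subst σ).subst τ = φ.subst fun p => (σ p).subst τ := by
  induction φ with
  | var p => rfl
  | bot => rfl
  | and φ ψ ihφ ihψ => exact congrArg₂ and ihφ ihψ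
  | or φ ψ ihφ ihψ => exact congrArg₂ or ihφ ihψ
  | imp φ ψ ihφ ihψ => exact congrArg₂ imp ihφ ihψ

theorem subst_var (φ : Form) : φ.subst var = φ := by
  induction φ with
  | var p => rfl
  | bot => rfl
  | and φ ψ ihφ ihψ => exact congrArg₂ and ihφ ihψ
  | or φ ψ ihφ ihψ => exact congrArg₂ or ihφ ihψ
  | imp φ ψ ihφ ihψ => exact congrArg₂ imp ihφ ihψ

theorem le_of_mem_vars_subst_shift {n p : ℕ} (φ : Form)
    (h : p ∈ (φ.subst fun i => var (i + n)).vars) : n ≤ p := by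
  induction φ with
  | var q =>
    have : p = q + n := h
    omega
  | bot => exact h.elim
  | and φ ψ ihφ ihψ => exact h.elim ihφ ihψ
  | or φ ψ ihφ ihψ => exact h.elim ihφ ihψ
  | imp φ ψ ihφ ihψ => exact h.elim ihφ ihψ

theorem subst_shift_unshift (n : ℕ) (φ : Form) :
    (φ.subst fun i => var (i + n)).subst (fun i => var (i - n)) = φ := by
  rw [subst_subst]
  simp only [subst, Nat.add_sub_cancel]
  exact φ.subst_var

theorem subst_foldr_and (σ : ℕ → Form) (l : List Form) :
    (l.foldr and top).subst σ = (l.map (subst σ)).foldr and top := by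
  induction l with
  | nil => rfl
  | cons φ l ih => exact congrArg _ ih

theorem notMem_vars_foldr_and {p : ℕ} {l : List Form} (h : ∀ φ ∈ l, p ∉ φ.vars) :
    p ∉ (l.foldr and top).vars := by
  induction l with
  | nil => exact fun hp => hp.elim id id
  | cons φ l ih =>
    exact fun hp => hp.elim (h φ List.mem_cons_self)
      (ih fun ψ hψ => h ψ (List.mem_cons_of_mem φ hψ))

end Form

theorem subst_bd_congr {k : ℕ} {σ τ : ℕ → Form} (h : ∀ i ≤ k, σ i = τ i) :
    (bd k).subst σ = (bd k).subst τ := by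
  induction k with
  | zero => rfl
  | succ k ih =>
    have h1 := h (k + 1) le_rfl
    have h2 := ih fun i hi => h i (hi.trans k.le_succ)
    simp only [bd, Form.subst, h1, h2]

/-! ### Theories -/

/-- A set of formulas containing `ML_n` and closed under modus ponens. -/
structure IsTheory (n : ℕ) (T : Set Form) : Prop where
  mln : ∀ {φ}, MLn n φ → φ ∈ T
  mp : ∀ {φ ψ}, Form.imp φ ψ ∈ T → φ ∈ T → ψ ∈ T

/-- A consistent theory with the disjunction property. -/
structure IsPrimeTheory (n : ℕ) (T : Set Form) : Prop extends IsTheory n T where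
  bot_notMem : Form.bot ∉ T
  or_mem : ∀ {φ ψ}, Form.or φ ψ ∈ T → φ ∈ T ∨ ψ ∈ T

namespace IsTheory

variable {n : ℕ} {T : Set Form} {φ ψ χ : Form}

theorem ipc (hT : IsTheory n T) (h : IPC φ) : φ ∈ T := hT.mln (.ipc h)

theorem imp_of_mem (hT : IsTheory n T) (h : ψ ∈ T) : φ.imp ψ ∈ T := hT.mp (hT.ipc (.ax1 _ _)) h

theorem imp_self (hT : IsTheory n T) (φ : Form) : φ.imp φ ∈ T :=
  hT.mp (hT.mp (hT.ipc (.ax2 φ (φ.imp φ) φ)) (hT.ipc (.ax1 _ _))) (hT.ipc (.ax1 _ _))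

/-- By the deduction theorem, the theory generated by `T` and `φ` consists of the consequents
of the implications in `T` with antecedent `φ`. -/
theorem adjoin (hT : IsTheory n T) (φ : Form) : IsTheory n {ψ | φ.imp ψ ∈ T} where
  mln h := hT.imp_of_mem (hT.mln h)
  mp h1 h2 := hT.mp (hT.mp (hT.ipc (.ax2 _ _ _)) h1) h2

theorem subset_adjoin (hT : IsTheory n T) (φ : Form) : T ⊆ {ψ | φ.imp ψ ∈ T} :=
  fun _ h => hT.imp_of_mem h

theorem imp_trans (hT : IsTheory n T) (h1 : φ.imp ψ ∈ T) (h2 : ψ.imp χ ∈ T) : φ.imp χ ∈ T :=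
  (hT.adjoin φ).mp (hT.subset_adjoin φ h2) h1

theorem and_mem (hT : IsTheory n T) : φ.and ψ ∈ T ↔ φ ∈ T ∧ ψ ∈ T :=
  ⟨fun h => ⟨hT.mp (hT.ipc (.andE1 _ _)) h, hT.mp (hT.ipc (.andE2 _ _)) h⟩,
    fun h => hT.mp (hT.mp (hT.ipc (.andI _ _)) h.1) h.2⟩

theorem or_mem_left (hT : IsTheory n T) (h : φ ∈ T) : φ.or ψ ∈ T := hT.mp (hT.ipc (.orI1 _ _)) h

theorem or_mem_right (hT : IsTheory n T) (h : ψ ∈ T) : φ.or ψ ∈ T := hT.mp (hT.ipc (.orI2 _ _)) h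

theorem or_imp (hT : IsTheory n T) (h1 : φ.imp χ ∈ T) (h2 : ψ.imp χ ∈ T) :
    (φ.or ψ).imp χ ∈ T :=
  hT.mp (hT.mp (hT.ipc (.orE _ _ _)) h1) h2

theorem neg_neg_mem (hT : IsTheory n T) (h : φ ∈ T) : φ.neg.neg ∈ T :=
  (hT.adjoin φ.neg).mp (hT.imp_self φ.neg) (hT.subset_adjoin _ h)

theorem neg_of_imp (hT : IsTheory n T) (h : φ.imp ψ ∈ T) (hψ : ψ.neg ∈ T) : φ.neg ∈ T :=
  hT.imp_trans h hψ

theorem neg_anti (hT : IsTheory n T) (h : φ.imp ψ ∈ T) : ψ.neg.imp φ.neg ∈ T :=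
  (hT.adjoin ψ.neg).neg_of_imp (hT.subset_adjoin _ h) (hT.imp_self _)

theorem foldr_and_mem (hT : IsTheory n T) {l : List Form} :
    l.foldr Form.and Form.top ∈ T ↔ ∀ φ ∈ l, φ ∈ T := by
  induction l with
  | nil => exact iff_of_true (hT.imp_self Form.bot) (by simp)
  | cons φ l ih => simp [hT.and_mem, ih]

theorem bigDisj_mem (hT : IsTheory n T) {m : ℕ} {F : Fin m → Form} {i : Fin m} (h : F i ∈ T) :
    bigDisj m F ∈ T := by
  suffices ∀ l : List (Fin m), i ∈ l → l.foldr (fun i acc => (F i).or acc) .bot ∈ T from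
    this _ (List.mem_finRange i)
  intro l hl
  induction l with
  | nil => simp at hl
  | cons j l ih =>
    rcases List.mem_cons.1 hl with rfl | hl
    · exact hT.or_mem_left h
    · exact hT.or_mem_right (ih hl)

theorem lam_mem (hT : IsTheory n T) {m : ℕ} {p : Fin m → ℕ} {i : Fin m} (h : lam m p i ∈ T) :
    Form.var (p i) ∈ T ∧ ∀ j, j ≠ i → (Form.var (p j)).neg ∈ T := by
  obtain ⟨h1, h2⟩ := hT.and_mem.1 h
  refine ⟨h1, fun j hj => ?_⟩
  rw [← List.foldr_map (f := fun j => (Form.var (p j)).neg) (g := Form.and),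
    hT.foldr_and_mem] at h2
  exact h2 _ (List.mem_map_of_mem (by simpa using hj))

/-- Lindenbaum's lemma. -/
theorem exists_prime (hT : IsTheory n T) (h : φ ∉ T) :
    ∃ M, T ⊆ M ∧ IsPrimeTheory n M ∧ φ ∉ M ∧
      ∀ U, IsTheory n U → φ ∉ U → M ⊆ U → U ⊆ M := by
  obtain ⟨M, hTM, ⟨hM, hφM⟩, hmax⟩ := zorn_subset_nonempty {U | IsTheory n U ∧ φ ∉ U} (by
    intro c hc hchain hne
    refine ⟨⋃₀ c, ⟨⟨?_, ?_⟩, ?_⟩, fun s => Set.subset_sUnion_of_mem⟩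
    · intro ψ hψ
      obtain ⟨U, hU⟩ := hne
      exact ⟨U, hU, (hc hU).1.mln hψ⟩
    · rintro ψ χ ⟨U, hU, h1⟩ ⟨W, hW, h2⟩
      rcases hchain.total hU hW with hUW | hWU
      · exact ⟨W, hW, (hc hW).1.mp (hUW h1) h2⟩
      · exact ⟨U, hU, (hc hU).1.mp h1 (hWU h2)⟩
    · rintro ⟨U, hU, hφ⟩
      exact (hc hU).2 hφ) T ⟨hT, h⟩
  have hmax' : ∀ U, IsTheory n U → φ ∉ U → M ⊆ U → U ⊆ M := fun U h1 h2 h3 => hmax ⟨h1, h2⟩ h3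
  have himp : ∀ ψ, ψ ∉ M → ψ.imp φ ∈ M := by
    intro ψ hψ
    by_contra hnot
    exact hψ (hmax' _ (hM.adjoin ψ) hnot (hM.subset_adjoin ψ) (hM.imp_self ψ))
  refine ⟨M, hTM, ⟨hM, fun hb => hφM (hM.mp (hM.ipc (.botE _)) hb), ?_⟩, hφM, hmax'⟩
  intro ψ χ hor
  by_contra! hnot
  exact hφM (hM.mp (hM.or_imp (himp ψ hnot.1) (himp χ hnot.2)) hor)

end IsTheory

theorem isTheory_proves (n : ℕ) (Γ : Set Form) : IsTheory n {φ | Proves n Γ φ} where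
  mln h := ⟨[], by simp, .mp (.ipc (.ax1 _ _)) h⟩
  mp := by
    rintro φ ψ ⟨l, hl, h1⟩ ⟨m, hm, h2⟩
    have hML : IsTheory n {φ | MLn n φ} := ⟨id, .mp⟩
    refine ⟨l ++ m, fun γ hγ => (List.mem_append.1 hγ).elim (hl γ) (hm γ), ?_⟩
    have hA := hML.adjoin ((l ++ m).foldr Form.and Form.top)
    have hmem := hA.foldr_and_mem.1 (hML.imp_self ((l ++ m).foldr Form.and Form.top))
    have hl' := hA.foldr_and_mem (l := l).2 fun γ hγ => hmem γ (List.mem_append_left m hγ)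
    have hm' := hA.foldr_and_mem (l := m).2 fun γ hγ => hmem γ (List.mem_append_right l hγ)
    exact hA.mp (hA.mp (hML.subset_adjoin _ h1) hl') (hA.mp (hML.subset_adjoin _ h2) hm')

theorem subset_proves (n : ℕ) (Γ : Set Form) : Γ ⊆ {φ | Proves n Γ φ} :=
  fun φ hφ => ⟨[φ], by simpa using hφ, .ipc (.andE1 _ _)⟩

/-- A set of hypotheses in which the variables of index less than `n` do not occur may be
supplemented with the premise of the rule `Ed_n`. -/
theorem Proves.of_shift {n : ℕ} {Γ : Set Form} {α : Form}
    (h : Proves n (Form.subst (fun i => .var (i + n)) '' Γ)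
      ((α.subst fun i => .var (i + n)).or
        (bigDisj n fun i => (lam n (fun i : Fin n => (i : ℕ)) i).neg))) :
    Proves n Γ α := by
  obtain ⟨l, hl, h⟩ := h
  have hvars : ∀ (i : Fin n) (φ : Form), (i : ℕ) ∉ (φ.subst fun i => .var (i + n)).vars :=
    fun i φ hi => absurd (φ.le_of_mem_vars_subst_shift hi) i.2.not_ge
  have h1 := MLn.ed (fun i : Fin n => (i : ℕ)) Fin.val_injective (fun i => ⟨by
    refine Form.notMem_vars_foldr_and fun φ hφ => ?_
    obtain ⟨γ, -, rfl⟩ := hl φ hφ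
    exact hvars i γ, hvars i α⟩) h
  have h2 := h1.subst fun i => .var (i - n)
  rw [Form.subst, Form.subst_shift_unshift, Form.subst_foldr_and] at h2
  refine ⟨_, fun φ hφ => ?_, h2⟩
  obtain ⟨ψ, hψ, rfl⟩ := List.mem_map.1 hφ
  obtain ⟨γ, hγ, rfl⟩ := hl ψ hψ
  rwa [Form.subst_shift_unshift]

/-! ### The canonical frame -/

/-- The canonical frame of `ML_n`: prime theories ordered by inclusion. -/
abbrev Canon (n : ℕ) : Type := {T : Set Form // IsPrimeTheory n T}

namespace Canon

variable {n : ℕ}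

theorem exists_isMax (x : Canon n) : ∃ e, IsMax e ∧ x ≤ e := by
  obtain ⟨M, hxM, hM, -, hmax⟩ := x.2.toIsTheory.exists_prime x.2.bot_notMem
  exact ⟨⟨M, hM⟩, fun y hy => hmax y.1 y.2.toIsTheory y.2.bot_notMem hy, hxM⟩

theorem exists_ge_mem {x : Canon n} {φ : Form} (h : φ.neg ∉ x.1) : ∃ y, x ≤ y ∧ φ ∈ y.1 := by
  obtain ⟨M, hxM, hM, -, -⟩ := (x.2.adjoin φ).exists_prime h
  exact ⟨⟨M, hM⟩, (x.2.subset_adjoin φ).trans hxM, hxM (x.2.imp_self φ)⟩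

theorem neg_mem_of_isMax {e : Canon n} (he : IsMax e) {φ : Form} (h : φ ∉ e.1) :
    φ.neg ∈ e.1 := by
  by_contra hnot
  obtain ⟨y, hey, hy⟩ := exists_ge_mem hnot
  exact h (he hey hy)

theorem kp_mem {T : Set Form} (hT : IsPrimeTheory n T) {δ φ ψ : Form}
    (h : δ.neg.imp (φ.or ψ) ∈ T) : δ.neg.imp φ ∈ T ∨ δ.neg.imp ψ ∈ T :=
  hT.or_mem (hT.mp (hT.mln (MLn.kp.subst fun i => if i = 0 then δ else if i = 1 then φ else ψ)) h)

theorem isKPOrder : IsKPOrder (Canon n) := by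
  intro x y z hxy hxz
  have hxT := x.2.toIsTheory
  let T : Set Form := {ψ | ∃ δ : Form, δ.neg ∈ y.1 ∧ δ.neg ∈ z.1 ∧ δ.neg.imp ψ ∈ x.1}
  have hxsub : x.1 ⊆ T := fun φ hφ =>
    ⟨.bot, y.2.imp_self _, z.2.imp_self _, x.2.imp_of_mem hφ⟩
  have hy : T ⊆ y.1 := fun φ ⟨δ, h1, _, h⟩ => y.2.mp (hxy h) h1
  have hz : T ⊆ z.1 := fun φ ⟨δ, _, h2, h⟩ => z.2.mp (hxz h) h2
  have hT : IsPrimeTheory n T := by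
    refine ⟨⟨fun h => hxsub (x.2.mln h), ?_⟩, fun h => y.2.bot_notMem (hy h), ?_⟩
    · rintro φ ψ ⟨δ, hy1, hz1, h1⟩ ⟨ε, hy2, hz2, h2⟩
      refine ⟨δ.or ε, y.2.or_imp hy1 hy2, z.2.or_imp hz1 hz2, ?_⟩
      exact (hxT.adjoin (δ.or ε).neg).mp
        (hxT.imp_trans (hxT.neg_anti (hxT.ipc (.orI1 _ _))) h1)
        (hxT.imp_trans (hxT.neg_anti (hxT.ipc (.orI2 _ _))) h2)
    · rintro φ ψ ⟨δ, h1, h2, h⟩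
      exact (kp_mem x.2 h).imp (fun h => ⟨δ, h1, h2, h⟩) fun h => ⟨δ, h1, h2, h⟩
  refine ⟨⟨T, hT⟩, hxsub, hy, hz, fun e he hTe => ?_⟩
  by_contra! hnot
  obtain ⟨β, hβ, hβe⟩ := Set.not_subset.1 hnot.1
  obtain ⟨γ, hγ, hγe⟩ := Set.not_subset.1 hnot.2
  have hmem : (β.or γ).neg.neg ∈ T :=
    ⟨(β.or γ).neg, y.2.neg_neg_mem (y.2.or_mem_left hβ), z.2.neg_neg_mem (z.2.or_mem_right hγ),
      hxT.imp_self _⟩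
  exact e.2.bot_notMem (e.2.mp (hTe hmem)
    (e.2.or_imp (neg_mem_of_isMax he hβe) (neg_mem_of_isMax he hγe)))

theorem exists_bd_notMem {k : ℕ} {x : Canon n} (h : HasChain k x) :
    ∃ σ, (bd k).subst σ ∉ x.1 := by
  induction k generalizing x with
  | zero => exact ⟨.var, x.2.bot_notMem⟩
  | succ k ih =>
    obtain ⟨y, hxy, hy⟩ := h
    obtain ⟨σ, hσ⟩ := ih hy
    obtain ⟨a, hay, hax⟩ := Set.exists_of_ssubset hxy
    refine ⟨Function.update σ (k + 1) a, fun hmem => ?_⟩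
    have hbd : (bd k).subst (Function.update σ (k + 1) a) = (bd k).subst σ :=
      subst_bd_congr fun i hi => Function.update_of_ne (by omega) _ _
    simp only [bd, Form.subst, Function.update_self, hbd] at hmem
    rcases x.2.or_mem hmem with h | h
    · exact hax h
    · exact hσ (y.2.mp (hxy.le h) hay)

theorem not_hasChain (x : Canon n) : ¬ HasChain n x := fun h => by
  obtain ⟨σ, hσ⟩ := exists_bd_notMem h
  exact hσ (x.2.mln (MLn.bdn.subst σ))

theorem forces_iff_mem (w : Canon n) (φ : Form) (x : Set.Ici w) :
    forces (fun p => {y : Set.Ici w | Form.var p ∈ y.1.1}) x φ ↔ φ ∈ x.1.1 := by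
  induction φ generalizing x with
  | var p => exact Iff.rfl
  | bot => exact ⟨False.elim, fun h => x.1.2.bot_notMem h⟩
  | and φ ψ ihφ ihψ => exact (and_congr (ihφ x) (ihψ x)).trans x.1.2.and_mem.symm
  | or φ ψ ihφ ihψ =>
    exact (or_congr (ihφ x) (ihψ x)).trans
      ⟨fun h => h.elim x.1.2.or_mem_left x.1.2.or_mem_right, x.1.2.or_mem⟩
  | imp φ ψ ihφ ihψ =>
    constructor
    · intro h
      by_contra hnot
      obtain ⟨M, hxM, hM, hψ, -⟩ := (x.1.2.adjoin φ).exists_prime hnot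
      have hle : x.1 ≤ ⟨M, hM⟩ := (x.1.2.subset_adjoin φ).trans hxM
      let v : Set.Ici w := ⟨⟨M, hM⟩, le_trans (Set.mem_Ici.1 x.2) hle⟩
      exact hψ ((ihψ v).1 (h v hle ((ihφ v).2 (hxM (x.1.2.imp_self φ)))))
    · intro h v hxv hv
      exact (ihψ v).2 (v.1.2.mp (hxv h) ((ihφ v).1 hv))

theorem hasChain_of_ici {w : Canon n} {k : ℕ} {x : Set.Ici w} (h : HasChain k x) :
    HasChain k x.1 := by
  induction k generalizing x with
  | zero => trivial
  | succ k ih =>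
    obtain ⟨y, hxy, hy⟩ := h
    exact ⟨y.1, hxy, ih hy⟩

theorem isMax_ici {w : Canon n} {x : Set.Ici w} : IsMax x ↔ IsMax x.1 :=
  ⟨fun h y hy => h (b := ⟨y, le_trans (Set.mem_Ici.1 x.2) hy⟩) hy, fun h _ hy => h hy⟩

theorem isKPOrder_ici (w : Canon n) : IsKPOrder (Set.Ici w) := by
  intro x y z hxy hxz
  obtain ⟨u, hxu, huy, huz, hu⟩ := isKPOrder x.1 y.1 z.1 hxy hxz
  exact ⟨⟨u, le_trans (Set.mem_Ici.1 x.2) hxu⟩, hxu, huy, huz,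
    fun e he hue => hu e.1 (isMax_ici.1 he) hue⟩

/-- The part of the canonical frame above a point refuting all `¬λ_i` is the `n`-Medvedev
frame. -/
theorem nonempty_orderIso_med {w : Canon n} {p : Fin n → ℕ}
    (hw : ∀ i, (lam n p i).neg ∉ w.1) : Nonempty (Set.Ici w ≃o Med n) := by
  have hex : ∀ i, ∃ e : Canon n, IsMax e ∧ w ≤ e ∧ lam n p i ∈ e.1 := fun i => by
    obtain ⟨y, hwy, hy⟩ := exists_ge_mem (hw i)
    obtain ⟨e, he, hye⟩ := exists_isMax y
    exact ⟨e, he, hwy.trans hye, hye hy⟩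
  choose e he hwe hlam using hex
  refine (isKPOrder_ici w).nonempty_orderIso_med (w := ⟨w, Set.self_mem_Ici⟩) (fun x => x.2) (fun x => ?_)
    (fun x hx => not_hasChain x.1 (hasChain_of_ici hx)) (fun i => ⟨e i, hwe i⟩) (fun i j hij => ?_)
    fun i => isMax_ici.2 (he i)
  · obtain ⟨m, hm, hxm⟩ := exists_isMax x.1
    exact ⟨⟨m, le_trans (Set.mem_Ici.1 x.2) hxm⟩, isMax_ici.2 hm, hxm⟩
  · by_contra hne
    have heq : e i = e j := congrArg Subtype.val hij
    have hj := hlam j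
    rw [← heq] at hj
    exact (e i).2.bot_notMem ((e i).2.mp (((e i).2.lam_mem hj).2 i hne)
      ((e i).2.lam_mem (hlam i)).1)

end Canon

/-- Strong completeness: `Γ ⊨_n α` implies `Γ ⊢_n α`. -/
theorem stmt11 (n : ℕ) (hn : 1 ≤ n) (Γ : Set Form) (α : Form)
    (h : Conseq Γ (root n hn) α) : Proves n Γ α := by
  by_contra hnot
  obtain ⟨M, hsub, hM, hα, -⟩ := (isTheory_proves n _).exists_prime (mt Proves.of_shift hnot)
  let w : Canon n := ⟨M, hM⟩
  obtain ⟨f⟩ := Canon.nonempty_orderIso_med (w := w) (p := fun i : Fin n => (i : ℕ))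
    fun i hi => hα (hM.or_mem_right (hM.bigDisj_mem hi))
  let r : Set.Ici w := ⟨w, Set.self_mem_Ici⟩
  have hr : f r = root n hn := le_antisymm
    (by rw [← f.le_symm_apply]; exact (f.symm (root n hn)).2) (Finset.subset_univ _)
  let V : ℕ → Set (Med n) := fun p => f '' {y : Set.Ici w | Form.var p ∈ y.1.1}
  let σ : ℕ → Form := fun i => .var (i + n)
  have key : ∀ φ, forces (fun p => {y | forces V y (σ p)}) (root n hn) φ ↔ φ.subst σ ∈ M :=
    fun φ => by
      rw [← forces_subst, ← hr]
      exact (forces_orderIso f _ _ r).trans (Canon.forces_iff_mem w _ r)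
  refine hα (hM.or_mem_left ((key α).1 (h _ ?_ fun γ hγ => (key γ).2
    (hsub (subset_proves n _ ⟨γ, hγ, rfl⟩)))))
  rintro p _ y hxy ⟨x, hx, rfl⟩
  obtain ⟨y, rfl⟩ := f.surjective y
  exact ⟨y, f.le_iff_le.1 hxy hx, rfl⟩
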